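/- arXiv:1006.3021 — 2 statements merged into one kernel-verified Lean document; each statement's English description precedes it below -/
import Mathlib

section
/- There is a propositional theory Γ (for instance Γ = {a} for an atom a) such that no propositional theory Γ' satisfies: for every HT-interpretation (X,Y), (X,Y) is an HT-countermodel of Γ if and only if (X,Y) is an HT-model of Γ'. -/
/-- Propositional formulas over atoms of type `α`. -/
inductive PForm (α : Type) : Type where
  | atom : α → PForm α
  | bot  : PForm α
  | conj : PForm α → PForm α → PForm α
  | disj : PForm α → PForm α → PForm α
  | impl : PForm α → PForm α → PForm α

namespace PForm

variable {α : Type}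

/-- Classical satisfaction by a set of atoms. -/
def clSat (Y : Set α) : PForm α → Prop
  | atom a   => a ∈ Y
  | bot      => False
  | conj φ ψ => clSat Y φ ∧ clSat Y ψ
  | disj φ ψ => clSat Y φ ∨ clSat Y ψ
  | impl φ ψ => clSat Y φ → clSat Y ψ

/-- HT-satisfaction by a pair (X,Y) of sets of atoms. -/
def htSat (X Y : Set α) : PForm α → Prop
  | atom a   => a ∈ X
  | bot      => False
  | conj φ ψ => htSat X Y φ ∧ htSat X Y ψ
  | disj φ ψ => htSat X Y φ ∨ htSat X Y ψ
  | impl φ ψ => (htSat X Y φ → htSat X Y ψ) ∧ (clSat Y φ → clSat Y ψ)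

/-- Factual formulas: built from ∧, ∨, ⊥ and negations φ → ⊥ only. -/
def Factual : PForm α → Prop
  | atom _   => True
  | bot      => True
  | conj φ ψ => Factual φ ∧ Factual ψ
  | disj φ ψ => Factual φ ∧ Factual ψ
  | impl φ ψ => Factual φ ∧ ψ = PForm.bot

/-- All atoms of the formula belong to `L`. -/
def atomsIn (L : Set α) : PForm α → Prop
  | atom a   => a ∈ L
  | bot      => True
  | conj φ ψ => atomsIn L φ ∧ atomsIn L ψ
  | disj φ ψ => atomsIn L φ ∧ atomsIn L ψ
  | impl φ ψ => atomsIn L φ ∧ atomsIn L ψ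

end PForm

abbrev Theory (α : Type) := Set (PForm α)

variable {α : Type}

/-- An HT-interpretation (X,Y) satisfies a theory. -/
def htSatT (X Y : Set α) (Γ : Theory α) : Prop := ∀ φ ∈ Γ, PForm.htSat X Y φ

/-- Classical satisfaction of a theory. -/
def clSatT (Y : Set α) (Γ : Theory α) : Prop := ∀ φ ∈ Γ, PForm.clSat Y φ

/-- A factual theory. -/
def FactualT (Γ : Theory α) : Prop := ∀ φ ∈ Γ, PForm.Factual φ

/-- Y is an answer set of Γ, i.e. (Y,Y) is an equilibrium model of Γ. -/
def IsAnswerSet (Γ : Theory α) (Y : Set α) : Prop :=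
  htSatT Y Y Γ ∧ ∀ X, X ⊂ Y → ¬ htSatT X Y Γ

/-- Answer-set equivalence. -/
def AnswerEquiv (Γ₁ Γ₂ : Theory α) : Prop :=
  ∀ Y : Set α, IsAnswerSet Γ₁ Y ↔ IsAnswerSet Γ₂ Y

/-- Classical equivalence. -/
def ClassEquiv (Γ₁ Γ₂ : Theory α) : Prop :=
  ∀ Y : Set α, clSatT Y Γ₁ ↔ clSatT Y Γ₂

/-- Strong equivalence. -/
def StrongEquiv (Γ₁ Γ₂ : Theory α) : Prop :=
  ∀ Γ : Theory α, AnswerEquiv (Γ₁ ∪ Γ) (Γ₂ ∪ Γ)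

/-- Uniform equivalence (wrt factual theories). -/
def UnifEquiv (Γ₁ Γ₂ : Theory α) : Prop :=
  ∀ Γ : Theory α, FactualT Γ → AnswerEquiv (Γ₁ ∪ Γ) (Γ₂ ∪ Γ)

/-- The set of HT-countermodels of Γ. -/
def Cs (Γ : Theory α) : Set (Set α × Set α) :=
  {p | p.1 ⊆ p.2 ∧ ¬ htSatT p.1 p.2 Γ}

/-- The set of equivalence interpretations of Γ: total HT-models and here-countermodels. -/
def Es (Γ : Theory α) : Set (Set α × Set α) :=
  {p | p.1 ⊆ p.2 ∧
    ((p.1 = p.2 ∧ htSatT p.1 p.2 Γ) ∨ (¬ htSatT p.1 p.2 Γ ∧ clSatT p.2 Γ))}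

/-- (X,Y) is there-closed in a set S of HT-interpretations. -/
def ThereClosedIn (S : Set (Set α × Set α)) (X Y : Set α) : Prop :=
  (Y, Y) ∉ S ∧ ∀ X', X ⊆ X' → X' ⊂ Y → (X', Y) ∈ S

/-- (X,Y) is closed in a set S of HT-interpretations. -/
def ClosedIn (S : Set (Set α × Set α)) (X Y : Set α) : Prop :=
  ∀ X', X ⊆ X' → X' ⊆ Y → (X', Y) ∈ S

/-- C_u(Γ): there-closed HT-interpretations wrt the countermodels of Γ. -/
def Cu (Γ : Theory α) : Set (Set α × Set α) :=
  {p | p.1 ⊆ p.2 ∧ ThereClosedIn (Cs Γ) p.1 p.2}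


theorem aux_ht_persist {X Y : Set α} (h : X ⊆ Y) (φ : PForm α) :
    PForm.htSat X Y φ → PForm.clSat Y φ := by
  induction φ with
  | atom a => exact fun ha => h ha
  | bot => exact id
  | conj φ ψ h1 h2 => exact fun hh => ⟨h1 hh.1, h2 hh.2⟩
  | disj φ ψ h1 h2 => exact fun hh => hh.imp h1 h2
  | impl φ ψ h1 h2 => exact fun hh => hh.2

theorem aux_cl_total {Y : Set α} (φ : PForm α) :
    PForm.clSat Y φ ↔ PForm.htSat Y Y φ := by
  induction φ with
  | atom a => exact Iff.rfl
  | bot => exact Iff.rfl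
  | conj φ ψ h1 h2 => simp only [PForm.clSat, PForm.htSat, h1, h2]
  | disj φ ψ h1 h2 => simp only [PForm.clSat, PForm.htSat, h1, h2]
  | impl φ ψ h1 h2 => simp only [PForm.clSat, PForm.htSat, h1, h2, and_self]

/-- There is a propositional theory Γ (e.g. Γ = {a}) such that no theory Γ'
has as its HT-models exactly the HT-countermodels of Γ. -/
theorem no_dual_theory_for_countermodels [Nonempty α] :
    ∃ Γ : Theory α, ¬ ∃ Γ' : Theory α,
      ∀ X Y : Set α, X ⊆ Y → ((X, Y) ∈ Cs Γ ↔ htSatT X Y Γ') := by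
  obtain ⟨a⟩ := ‹Nonempty α›
  refine ⟨{PForm.atom a}, ?_⟩
  rintro ⟨Γ', hG⟩
  have h1 : htSatT ∅ {a} Γ' := by
    refine (hG ∅ {a} (Set.empty_subset _)).1 ⟨Set.empty_subset _, fun h => ?_⟩
    exact h (PForm.atom a) rfl
  have h2 : htSatT {a} {a} Γ' := fun φ hφ =>
    (aux_cl_total φ).1 (aux_ht_persist (Set.empty_subset _) φ (h1 φ hφ))
  refine ((hG {a} {a} subset_rfl).2 h2).2 ?_
  rintro φ rfl
  exact Set.mem_singleton a
end

section
/- Two propositional theories Γ1 and Γ2 are relativized hyperequivalent wrt. A⁺ and A⁻ if and only if they coincide on their HT-hyperequivalence interpretations wrt. A⁺ and A⁻, i.e., Γ1 ≡^{A⁺}_{A⁻} Γ2 iff E^{A⁺}_{A⁻}(Γ1) = E^{A⁺}_{A⁻}(Γ2). -/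
variable {α : Type}

/-- Polarity-correct occurrence of atoms: `APol Ap An true φ` states that the formula φ,
itself occurring positively, has all its positively occurring atoms in `Ap` and all its
negatively occurring atoms in `An` (atoms in antecedents of implications occur negatively,
atoms in consequents occur positively; in a negatively occurring implication — e.g. the
antecedent φ₁ of (φ₁→φ₂)→φ₃ — both components additionally occur with both polarities). -/
def APol (Ap An : Set α) : Bool → PForm α → Prop
  | p, .atom a => if p then a ∈ Ap else a ∈ An
  | _, .bot => True
  | p, .conj φ ψ => APol Ap An p φ ∧ APol Ap An p ψ
  | p, .disj φ ψ => APol Ap An p φ ∧ APol Ap An p ψ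
  | true, .impl φ ψ => APol Ap An false φ ∧ APol Ap An true ψ
  | false, .impl φ ψ =>
      (APol Ap An false φ ∧ APol Ap An true φ) ∧ (APol Ap An true ψ ∧ APol Ap An false ψ)

/-- An A⁺-A⁻-theory. -/
def IsAATheory (Ap An : Set α) (Γ : Theory α) : Prop :=
  ∀ φ ∈ Γ, APol Ap An true φ

/-- An extended A⁺-A⁻-theory: additionally factual formulas over A⁺ are permitted. -/
def IsExtAATheory (Ap An : Set α) (Γ : Theory α) : Prop :=
  ∀ φ ∈ Γ, APol Ap An true φ ∨ (PForm.Factual φ ∧ PForm.atomsIn Ap φ)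

/-- Relativized hyperequivalence wrt A⁺ and A⁻. -/
def HyperEquiv (Ap An : Set α) (Γ₁ Γ₂ : Theory α) : Prop :=
  ∀ Γ : Theory α, IsAATheory Ap An Γ → AnswerEquiv (Γ₁ ∪ Γ) (Γ₂ ∪ Γ)

/-- (Y,Y) is A⁺-total: (Y ∩ A⁺, Y) is closed in E_s(Γ). -/
def ApTotal (Ap : Set α) (Γ : Theory α) (Y : Set α) : Prop :=
  ∀ X', Y ∩ Ap ⊆ X' → X' ⊆ Y → (X', Y) ∈ Es Γ

/-- (X,Y) is A⁺-closed in E_s(Γ). -/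
def ApClosed (Ap An : Set α) (Γ : Theory α) (X Y : Set α) : Prop :=
  ∀ X', X' ⊆ Y → X ∩ Ap ⊆ X' ∩ Ap → X' ∩ An ⊆ X ∩ An → (X', Y) ∈ Es Γ

/-- E^{A⁺}_{A⁻}(Γ): the HT-hyperequivalence interpretations of Γ wrt A⁺ and A⁻. -/
def Eh (Ap An : Set α) (Γ : Theory α) : Set (Set α × Set α) :=
  {p | p.1 ⊆ p.2 ∧ ApTotal Ap Γ p.2 ∧
    ∃ X', X' ⊆ p.2 ∧ p.1 = X' ∩ (Ap ∪ An) ∧ ApClosed Ap An Γ X' p.2}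

theorem aux_tot (Y : Set α) (φ : PForm α) : PForm.htSat Y Y φ ↔ PForm.clSat Y φ := by
  induction φ <;> simp_all [PForm.htSat, PForm.clSat]

theorem aux_totT (Y : Set α) (Γ : Theory α) : htSatT Y Y Γ ↔ clSatT Y Γ := by
  simp [htSatT, clSatT, aux_tot]

theorem aux_pol (Ap An X X' Y : Set α) (h1 : X ∩ Ap ⊆ X' ∩ Ap)
    (h2 : X' ∩ An ⊆ X ∩ An) (φ : PForm α) :
    (APol Ap An true φ → PForm.htSat X Y φ → PForm.htSat X' Y φ) ∧
    (APol Ap An false φ → PForm.htSat X' Y φ → PForm.htSat X Y φ) := by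
  induction φ with
  | atom a =>
    simp only [APol, PForm.htSat]
    exact ⟨fun h hx => (h1 ⟨hx, by simpa using h⟩).1, fun h hx => (h2 ⟨hx, by simpa using h⟩).1⟩
  | bot => simp [PForm.htSat]
  | conj φ ψ i j => simp only [APol, PForm.htSat]; tauto
  | disj φ ψ i j => simp only [APol, PForm.htSat]; tauto
  | impl φ ψ i j => simp only [APol, PForm.htSat]; tauto

theorem aux_polT (Ap An X X' Y : Set α) (h1 : X ∩ Ap ⊆ X' ∩ Ap)
    (h2 : X' ∩ An ⊆ X ∩ An) (Γ : Theory α) (hΓ : IsAATheory Ap An Γ) (h : htSatT X Y Γ) :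
    htSatT X' Y Γ :=
  fun φ hφ => (aux_pol Ap An X X' Y h1 h2 φ).1 (hΓ φ hφ) (h φ hφ)

theorem aux_union (X Y : Set α) (Γ Δ : Theory α) :
    htSatT X Y (Γ ∪ Δ) ↔ htSatT X Y Γ ∧ htSatT X Y Δ := by
  simp only [htSatT, Set.mem_union, or_imp, forall_and]

theorem aux_Es (X Y : Set α) (Γ : Theory α) :
    (X, Y) ∈ Es Γ ↔ X ⊆ Y ∧ clSatT Y Γ ∧ (X ≠ Y → ¬ htSatT X Y Γ) := by
  simp only [Es, Set.mem_setOf_eq]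
  by_cases h : X = Y
  · subst h; simp [aux_totT]
  · simp [h]; tauto

theorem aux_closed_total (Ap An Y : Set α) (Γ : Theory α) (h : ApTotal Ap Γ Y) :
    ApClosed Ap An Γ Y Y :=
  fun X' hX h1 _ => h X' (fun _ ha => (h1 ha).1) hX

theorem aux_mp (Ap An : Set α) (Γ₁ Γ₂ : Theory α) (h : Eh Ap An Γ₁ = Eh Ap An Γ₂)
    (Γ : Theory α) (hΓ : IsAATheory Ap An Γ) (Y : Set α) (hY : IsAnswerSet (Γ₁ ∪ Γ) Y) :
    IsAnswerSet (Γ₂ ∪ Γ) Y := by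
  obtain ⟨hm, hmin⟩ := hY
  rw [aux_union] at hm
  obtain ⟨hm1, hmΓ⟩ := hm
  have hcl1 := (aux_totT _ _).1 hm1
  have key : ∀ X, X ⊆ Y → htSatT X Y Γ → ApClosed Ap An Γ₁ X Y := by
    intro X _ hX X' hX' h1 h2
    rw [aux_Es]
    refine ⟨hX', hcl1, fun hne hs => hmin X' (hX'.ssubset_of_ne hne) ?_⟩
    exact (aux_union _ _ _ _).2 ⟨hs, aux_polT Ap An X X' Y h1 h2 Γ hΓ hX⟩
  have htot : ApTotal Ap Γ₁ Y := by
    intro X' h1 h2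
    exact key Y subset_rfl hmΓ X' h2 (fun a ha => ⟨h1 ha, ha.2⟩) (fun a ha => ⟨h2 ha.1, ha.2⟩)
  have key2 : ∀ X, X ⊆ Y → htSatT X Y Γ → (X, Y) ∈ Es Γ₂ := by
    intro X hXY hX
    have hmem : (X ∩ (Ap ∪ An), Y) ∈ Eh Ap An Γ₁ :=
      ⟨fun a ha => hXY ha.1, htot, X, hXY, rfl, key X hXY hX⟩
    rw [h] at hmem
    obtain ⟨_, _, X', _, he, hc⟩ := hmem
    have he' : ∀ a, a ∈ X ∩ (Ap ∪ An) ↔ a ∈ X' ∩ (Ap ∪ An) := fun a => by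
      simp only at he; rw [he]
    refine hc X hXY (fun a ha => ⟨((he' a).2 ⟨ha.1, Or.inl ha.2⟩).1, ha.2⟩)
      (fun a ha => ⟨((he' a).1 ⟨ha.1, Or.inr ha.2⟩).1, ha.2⟩)
  refine ⟨(aux_union _ _ _ _).2 ⟨(aux_totT _ _).2 ?_, hmΓ⟩, ?_⟩
  · exact ((aux_Es _ _ _).1 (key2 Y subset_rfl hmΓ)).2.1
  · intro X hX hs
    rw [aux_union] at hs
    exact ((aux_Es _ _ _).1 (key2 X hX.subset hs.2)).2.2 hX.ne hs.1

theorem aux_mpr (Ap An : Set α) (Γ₁ Γ₂ : Theory α) (h : HyperEquiv Ap An Γ₁ Γ₂) :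
    Eh Ap An Γ₁ ⊆ Eh Ap An Γ₂ := by
  rintro ⟨X, Y⟩ ⟨hXY, htot, X', hX'Y, he, hc⟩
  simp only at hXY htot hX'Y he hc
  have hcl1 : clSatT Y Γ₁ :=
    ((aux_Es _ _ _).1 (htot Y Set.inter_subset_left subset_rfl)).2.1
  have main : ∀ Z, Z ⊆ Y → ApClosed Ap An Γ₁ Z Y → (Z, Y) ∈ Es Γ₂ := by
    intro Z hZ hcZ
    let Γ : Theory α := {φ | (∃ a ∈ Z ∩ Ap, φ = .atom a) ∨
      ∃ a ∈ (Y \ Z) ∩ An, ∃ b ∈ Y ∩ Ap, φ = .impl (.atom a) (.atom b)}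
    have hΓ : IsAATheory Ap An Γ := by
      rintro φ (⟨a, ha, rfl⟩ | ⟨a, ha, b, hb, rfl⟩)
      · simpa [APol] using ha.2
      · simpa [APol] using ⟨ha.2, hb.2⟩
    have hsat : ∀ W, Z ∩ Ap ⊆ W → ((W ∩ An ⊆ Z) ∨ Y ∩ Ap ⊆ W) → htSatT W Y Γ := by
      rintro W hW hor φ (⟨a, ha, rfl⟩ | ⟨a, ha, b, hb, rfl⟩)
      · exact hW ha
      · refine ⟨fun hw => ?_, fun _ => hb.1⟩
        rcases hor with hor | hor
        · exact absurd (hor ⟨hw, ha.2⟩) ha.1.2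
        · exact hor hb
    have hans : IsAnswerSet (Γ₁ ∪ Γ) Y := by
      refine ⟨(aux_union _ _ _ _).2 ⟨(aux_totT _ _).2 hcl1,
        hsat Y (fun a ha => hZ ha.1) (Or.inr Set.inter_subset_left)⟩, ?_⟩
      intro W hW hs
      rw [aux_union] at hs
      obtain ⟨hs1, hsΓ⟩ := hs
      have hWZ : Z ∩ Ap ⊆ W := fun a ha => hsΓ (.atom a) (Or.inl ⟨a, ha, rfl⟩)
      by_cases hn : W ∩ An ⊆ Z
      · exact ((aux_Es _ _ _).1 (hcZ W hW.subset (fun a ha => ⟨hWZ ha, ha.2⟩)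
          (fun a ha => ⟨hn ha, ha.2⟩))).2.2 hW.ne hs1
      · obtain ⟨a, ha, haZ⟩ := Set.not_subset.1 hn
        refine ((aux_Es _ _ _).1 (htot W (fun b hb => ?_) hW.subset)).2.2 hW.ne hs1
        exact (hsΓ (.impl (.atom a) (.atom b))
          (Or.inr ⟨a, ⟨⟨hW.subset ha.1, haZ⟩, ha.2⟩, b, hb, rfl⟩)).1 ha.1
    have hans2 := (h Γ hΓ Y).1 hans
    refine (aux_Es _ _ _).2 ⟨hZ, (aux_totT _ _).1 ((aux_union _ _ _ _).1 hans2.1).1, ?_⟩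
    intro hne hs
    exact hans2.2 Z (hZ.ssubset_of_ne hne) ((aux_union _ _ _ _).2
      ⟨hs, hsat Z Set.inter_subset_left (Or.inl Set.inter_subset_left)⟩)
  have trans : ∀ Z, ApClosed Ap An Γ₁ Z Y → ApClosed Ap An Γ₂ Z Y := by
    intro Z hcZ W hW h1 h2
    exact main W hW (fun V hV h3 h4 => hcZ V hV (h1.trans h3) (h4.trans h2))
  refine ⟨hXY, ?_, X', hX'Y, he, trans X' hc⟩
  intro W h1 h2
  exact trans Y (aux_closed_total Ap An Y Γ₁ htot) W h2 (fun a ha => ⟨h1 ha, ha.2⟩)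
    (fun a ha => ⟨h2 ha.1, ha.2⟩)

/-- Γ₁ and Γ₂ are relativized hyperequivalent wrt A⁺ and A⁻ iff they
coincide on their HT-hyperequivalence interpretations wrt A⁺ and A⁻. -/
theorem hyperequivalence_characterization (Ap An : Set α) (Γ₁ Γ₂ : Theory α) :
    HyperEquiv Ap An Γ₁ Γ₂ ↔ Eh Ap An Γ₁ = Eh Ap An Γ₂ := by
  constructor
  · intro h
    exact Set.Subset.antisymm (aux_mpr Ap An Γ₁ Γ₂ h)
      (aux_mpr Ap An Γ₂ Γ₁ (fun Γ hΓ Y => (h Γ hΓ Y).symm))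
  · intro h Γ hΓ Y
    exact ⟨aux_mp Ap An Γ₁ Γ₂ h Γ hΓ Y, aux_mp Ap An Γ₂ Γ₁ h.symm Γ hΓ Y⟩
end
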